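/- For every k ≥ 1, d(a_k, E) = 4k², where a_k = W^{−k} V^k W^k V^{−k} is a word of length 12k in the generators σ_1, σ_2 of B_3 representing the identity element, and E is the empty word: the minimal number of applications of the relation σ_1σ_2σ_1 = σ_2σ_1σ_2 needed to transform a_k into the empty word is exactly 4k². -/

import Mathlib

namespace Braid

/-- A letter `σ_i^{±1}`: generator index `i` and sign (`true` = `σ_i`, `false` = `σ_i⁻¹`). -/
abbrev BraidLetter : Type := ℕ × Bool

/-- A word in the braid generators: a finite sequence of letters `σ_i^{±1}`. -/
abbrev BraidWord : Type := List BraidLetter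

/-- `w` is a word in the generators `σ_1, …, σ_{n-1}` of `B_n`. -/
def IsWord (n : ℕ) (w : BraidWord) : Prop := ∀ l ∈ w, 1 ≤ l.1 ∧ l.1 < n

/-- The relators of the braid group `B_n`, inside the free group on generators
indexed by `ℕ` (only the generators `σ_1, …, σ_{n-1}` are involved in relations,
so that on words in these generators the presented group is exactly `B_n`). -/
def braidRels (n : ℕ) : Set (FreeGroup ℕ) :=
  {r | ∃ i : ℕ, 1 ≤ i ∧ i + 2 ≤ n ∧
      r = FreeGroup.of i * FreeGroup.of (i+1) * FreeGroup.of i *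
          (FreeGroup.of (i+1) * FreeGroup.of i * FreeGroup.of (i+1))⁻¹} ∪
  {r | ∃ i j : ℕ, 1 ≤ i ∧ 1 ≤ j ∧ i < n ∧ j < n ∧ i + 2 ≤ j ∧
      r = FreeGroup.of i * FreeGroup.of j * (FreeGroup.of j * FreeGroup.of i)⁻¹}

/-- The braid group `B_n`, presented by the generators `σ_i` and the braid relations. -/
abbrev BraidGroup (n : ℕ) := PresentedGroup (braidRels n)

/-- The element of `B_n` represented by a single letter `σ_i^{±1}`. -/
def evalLetter (n : ℕ) (l : BraidLetter) : BraidGroup n :=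
  if l.2 then PresentedGroup.of l.1 else (PresentedGroup.of l.1)⁻¹

/-- The element of `B_n` represented by a word. -/
def eval (n : ℕ) (w : BraidWord) : BraidGroup n := (w.map (evalLetter n)).prod

/-- Type (1) elementary modification: replacing a subword `σ_i σ_{i+1} σ_i` by
`σ_{i+1} σ_i σ_{i+1}` or vice versa, `1 ≤ i ≤ n - 2`. -/
inductive Move1 (n : ℕ) : BraidWord → BraidWord → Prop
  | fwd (u v : BraidWord) (i : ℕ) (h1 : 1 ≤ i) (h2 : i + 2 ≤ n) :
      Move1 n (u ++ [(i, true), (i+1, true), (i, true)] ++ v)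
              (u ++ [(i+1, true), (i, true), (i+1, true)] ++ v)
  | bwd (u v : BraidWord) (i : ℕ) (h1 : 1 ≤ i) (h2 : i + 2 ≤ n) :
      Move1 n (u ++ [(i+1, true), (i, true), (i+1, true)] ++ v)
              (u ++ [(i, true), (i+1, true), (i, true)] ++ v)

/-- Type (2) elementary modification: replacing a subword `σ_i σ_j` by `σ_j σ_i`
for `|i - j| ≥ 2` (in either direction, as `i` and `j` are symmetric). -/
inductive Move2 (n : ℕ) : BraidWord → BraidWord → Prop
  | swap (u v : BraidWord) (i j : ℕ) (h1 : 1 ≤ i) (h2 : 1 ≤ j)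
      (h3 : i < n) (h4 : j < n) (h5 : i + 2 ≤ j ∨ j + 2 ≤ i) :
      Move2 n (u ++ [(i, true), (j, true)] ++ v)
              (u ++ [(j, true), (i, true)] ++ v)

/-- Type (3) elementary modification: deleting or inserting a subword
`σ_i σ_i⁻¹` or `σ_i⁻¹ σ_i`. -/
inductive Move3 (n : ℕ) : BraidWord → BraidWord → Prop
  | del (u v : BraidWord) (i : ℕ) (b : Bool) (h1 : 1 ≤ i) (h2 : i < n) :
      Move3 n (u ++ [(i, b), (i, !b)] ++ v) (u ++ v)
  | ins (u v : BraidWord) (i : ℕ) (b : Bool) (h1 : 1 ≤ i) (h2 : i < n) :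
      Move3 n (u ++ v) (u ++ [(i, b), (i, !b)] ++ v)

/-- `Reach n c a b`: there is a finite sequence of elementary modifications in `B_n`
transforming `a` into `b` and containing exactly `c` modifications of type (1). -/
inductive Reach (n : ℕ) : ℕ → BraidWord → BraidWord → Prop
  | refl (a : BraidWord) : Reach n 0 a a
  | step1 {a b c : BraidWord} {k : ℕ} : Move1 n a b → Reach n k b c → Reach n (k+1) a c
  | step2 {a b c : BraidWord} {k : ℕ} : Move2 n a b → Reach n k b c → Reach n k a c
  | step3 {a b c : BraidWord} {k : ℕ} : Move3 n a b → Reach n k b c → Reach n k a c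

/-- The distance `d(a,b)`: the minimal number of type (1) modifications among all
finite sequences of elementary modifications transforming `a` into `b`. -/
noncomputable def braidDist (n : ℕ) (a b : BraidWord) : ℕ := sInf {c | Reach n c a b}


/-- The `k`-fold concatenation `w^k` of a word. -/
def wpow (w : BraidWord) (k : ℕ) : BraidWord := (List.replicate k w).flatten

/-- The formal inverse `w⁻¹` of a word: letters inverted and order reversed. -/
def winv (w : BraidWord) : BraidWord := w.reverse.map (fun l => (l.1, !l.2))

/-- The word `V = σ_1²`. -/
def V : BraidWord := [(1, true), (1, true)]

/-- The word `W = σ_2 σ_1² σ_2`. -/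
def W : BraidWord := [(2, true), (1, true), (1, true), (2, true)]

/-- The word `a_k = W^{-k} V^k W^k V^{-k}`. -/
def ak (k : ℕ) : BraidWord := winv (wpow W k) ++ wpow V k ++ wpow W k ++ winv (wpow V k)

/-- The word `b_k = W^{-k} W^k V^k V^{-k}`. -/
def bk (k : ℕ) : BraidWord := winv (wpow W k) ++ wpow W k ++ wpow V k ++ winv (wpow V k)


/-! ### Sequences of modifications -/

lemma Reach.trans {n c d : ℕ} {a b e : BraidWord} (h : Reach n c a b) (h' : Reach n d b e) :
    Reach n (c + d) a e := by
  induction h with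
  | refl a => simpa using h'
  | step1 m _ ih => rw [Nat.add_right_comm]; exact .step1 m (ih h')
  | step2 m _ ih => exact .step2 m (ih h')
  | step3 m _ ih => exact .step3 m (ih h')

lemma Move1.context {n : ℕ} {a b : BraidWord} (x y : BraidWord) (h : Move1 n a b) :
    Move1 n (x ++ a ++ y) (x ++ b ++ y) := by
  cases h with
  | fwd u v i h1 h2 => simpa using Move1.fwd (x ++ u) (v ++ y) i h1 h2
  | bwd u v i h1 h2 => simpa using Move1.bwd (x ++ u) (v ++ y) i h1 h2

lemma Move2.context {n : ℕ} {a b : BraidWord} (x y : BraidWord) (h : Move2 n a b) :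
    Move2 n (x ++ a ++ y) (x ++ b ++ y) := by
  cases h with
  | swap u v i j h1 h2 h3 h4 h5 =>
    simpa using Move2.swap (x ++ u) (v ++ y) i j h1 h2 h3 h4 h5

lemma Move3.context {n : ℕ} {a b : BraidWord} (x y : BraidWord) (h : Move3 n a b) :
    Move3 n (x ++ a ++ y) (x ++ b ++ y) := by
  cases h with
  | del u v i b h1 h2 => simpa using Move3.del (x ++ u) (v ++ y) i b h1 h2
  | ins u v i b h1 h2 => simpa using Move3.ins (x ++ u) (v ++ y) i b h1 h2

lemma Reach.context {n c : ℕ} {a b : BraidWord} (x y : BraidWord) (h : Reach n c a b) :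
    Reach n c (x ++ a ++ y) (x ++ b ++ y) := by
  induction h with
  | refl a => exact .refl _
  | step1 m _ ih => exact .step1 (m.context x y) ih
  | step2 m _ ih => exact .step2 (m.context x y) ih
  | step3 m _ ih => exact .step3 (m.context x y) ih

lemma wpow_succ (w : BraidWord) (k : ℕ) : wpow w (k + 1) = w ++ wpow w k := by
  simp [wpow, List.replicate_succ]

lemma wpow_succ' (w : BraidWord) (k : ℕ) : wpow w (k + 1) = wpow w k ++ w := by
  simp [wpow, List.replicate_succ']

lemma Reach.wpow_left {n c : ℕ} {x y : BraidWord} (h : Reach n c (x ++ y) (y ++ x)) (k : ℕ) :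
    Reach n (k * c) (wpow x k ++ y) (y ++ wpow x k) := by
  induction k with
  | zero => simpa [wpow] using Reach.refl (n := n) y
  | succ k ih =>
    have h1 := ih.context x []
    have h2 := h.context [] (wpow x k)
    simp only [List.append_nil, List.nil_append, List.append_assoc] at h1 h2
    rw [wpow_succ, Nat.succ_mul, List.append_assoc]
    exact h1.trans h2

lemma Reach.wpow_right {n c : ℕ} {x y : BraidWord} (h : Reach n c (x ++ y) (y ++ x)) (k : ℕ) :
    Reach n (k * c) (x ++ wpow y k) (wpow y k ++ x) := by
  induction k with
  | zero => simpa [wpow] using Reach.refl (n := n) x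
  | succ k ih =>
    have h1 := ih.context [] y
    have h2 := h.context (wpow y k) []
    simp only [List.append_nil, List.nil_append, List.append_assoc] at h1 h2
    rw [wpow_succ', Nat.succ_mul, List.append_assoc]
    exact h1.trans h2

lemma reach_append_winv {n : ℕ} {w : BraidWord} (hw : IsWord n w) :
    Reach n 0 (w ++ winv w) [] := by
  induction w with
  | nil => exact .refl _
  | cons l w ih =>
    have h := (ih fun x hx => hw x (List.mem_cons_of_mem _ hx)).context [l] [(l.1, !l.2)]
    have hl := hw l List.mem_cons_self
    have m := Move3.del (n := n) [] [] l.1 l.2 hl.1 hl.2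
    simpa [winv] using h.trans (.step3 m (.refl _))

lemma winv_winv (w : BraidWord) : winv (winv w) = w := by
  simp [winv, Function.comp_def]

lemma IsWord.winv {n : ℕ} {w : BraidWord} (hw : IsWord n w) : IsWord n (winv w) := by
  intro l hl
  simp only [Braid.winv, List.mem_map, List.mem_reverse] at hl
  obtain ⟨x, hx, rfl⟩ := hl
  exact hw x hx

lemma reach_winv_append {n : ℕ} {w : BraidWord} (hw : IsWord n w) :
    Reach n 0 (winv w ++ w) [] := by
  simpa [winv_winv] using reach_append_winv hw.winv

lemma IsWord.wpow {n : ℕ} {w : BraidWord} (hw : IsWord n w) (k : ℕ) : IsWord n (wpow w k) := by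
  intro l hl
  simp only [Braid.wpow, List.mem_flatten, List.mem_replicate] at hl
  obtain ⟨x, ⟨-, rfl⟩, hx⟩ := hl
  exact hw l hx

lemma isWord_V : IsWord 3 V := by simp [IsWord, V]

lemma isWord_W : IsWord 3 W := by simp [IsWord, W]

lemma reach_sigma_one_W : Reach 3 2 ([(1, true)] ++ W) (W ++ [(1, true)]) :=
  .step1 (Move1.fwd [] [(1, true), (2, true)] 1 le_rfl le_rfl)
    (.step1 (Move1.bwd [(2, true), (1, true)] [] 1 le_rfl le_rfl) (.refl _))

lemma reach_ak (k : ℕ) : Reach 3 (4 * k ^ 2) (ak k) [] := by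
  have hV : Reach 3 (2 * 2) (V ++ W) (W ++ V) := reach_sigma_one_W.wpow_left 2
  have h1 := ((hV.wpow_left k).wpow_right k).context (winv (wpow W k)) (winv (wpow V k))
  have h2 := (reach_winv_append (isWord_W.wpow k)).context [] (wpow V k ++ winv (wpow V k))
  have h := h1.trans ((by simpa using h2 : Reach 3 0 _ _).trans
    (reach_append_winv (isWord_V.wpow k)))
  have e : 4 * k ^ 2 = k * (k * (2 * 2)) + (0 + 0) := by ring
  rw [e, ak]
  simpa using h

/-! ### Evaluation in the braid group -/

lemma eval_append (n : ℕ) (u v : BraidWord) : eval n (u ++ v) = eval n u * eval n v := by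
  simp [eval]

lemma Move1.eval_eq {n : ℕ} {a b : BraidWord} (h : Move1 n a b) : eval n a = eval n b := by
  have key (i : ℕ) (h1 : 1 ≤ i) (h2 : i + 2 ≤ n) :
      eval n [(i, true), (i + 1, true), (i, true)] =
        eval n [(i + 1, true), (i, true), (i + 1, true)] := by
    have h := PresentedGroup.one_of_mem (rels := braidRels n) (Or.inl ⟨i, h1, h2, rfl⟩)
    simp only [map_mul, map_inv] at h
    simpa [eval, evalLetter, PresentedGroup.of, mul_assoc] using mul_inv_eq_one.mp h
  cases h with
  | fwd u v i h1 h2 => simp only [eval_append, key i h1 h2]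
  | bwd u v i h1 h2 => simp only [eval_append, key i h1 h2]

lemma Move2.eval_eq {n : ℕ} {a b : BraidWord} (h : Move2 n a b) : eval n a = eval n b := by
  have key (i j : ℕ) (h1 : 1 ≤ i) (h2 : 1 ≤ j) (h3 : i < n) (h4 : j < n) (h5 : i + 2 ≤ j) :
      eval n [(i, true), (j, true)] = eval n [(j, true), (i, true)] := by
    have h := PresentedGroup.one_of_mem (rels := braidRels n)
      (Or.inr ⟨i, j, h1, h2, h3, h4, h5, rfl⟩)
    simp only [map_mul, map_inv] at h
    simpa [eval, evalLetter, PresentedGroup.of] using mul_inv_eq_one.mp h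
  cases h with
  | swap u v i j h1 h2 h3 h4 h5 =>
    rcases h5 with h5 | h5
    · simp only [eval_append, key i j h1 h2 h3 h4 h5]
    · simp only [eval_append, key j i h2 h1 h4 h3 h5]

lemma Move3.eval_eq {n : ℕ} {a b : BraidWord} (h : Move3 n a b) : eval n a = eval n b := by
  have key (i : ℕ) (b : Bool) : eval n [(i, b), (i, !b)] = 1 := by
    cases b <;> simp [eval, evalLetter]
  cases h with
  | del u v i b h1 h2 => simp only [eval_append, key, mul_one]
  | ins u v i b h1 h2 => simp only [eval_append, key, mul_one]

lemma Reach.eval_eq {n c : ℕ} {a b : BraidWord} (h : Reach n c a b) : eval n a = eval n b := by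
  induction h with
  | refl a => rfl
  | step1 m _ ih => exact m.eval_eq.trans ih
  | step2 m _ ih => exact m.eval_eq.trans ih
  | step3 m _ ih => exact m.eval_eq.trans ih

/-! ### A one-cochain on `SL₂(ℤ)` with small coboundary

The letters `σ₁`, `σ₂` act by right multiplication on integer matrices through
`B₃ → SL₂(ℤ)`. The functions `edgePot` and `vertexPot` are a potential on the two kinds of
vertices of the tree of `PSL₂(ℤ)`: twice the position of the projection to the horocycle at
infinity. The induced functional on words changes by at most `6` under a braid relation. -/

/-- The integer matrix with rows `(p, q)` and `(r, s)`. -/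
@[ext]
structure IntMat where
  /-- upper left entry -/
  p : ℤ
  /-- upper right entry -/
  q : ℤ
  /-- lower left entry -/
  r : ℤ
  /-- lower right entry -/
  s : ℤ

namespace IntMat

/-- The determinant. -/
def det (g : IntMat) : ℤ := g.p * g.s - g.q * g.r

/-- Right multiplication by the image of a letter: `σ₁` goes to the matrix with rows `(1, 1)`,
`(0, 1)`, and every other generator to the one with rows `(1, 0)`, `(-1, 1)`. -/
def act (g : IntMat) (l : BraidLetter) : IntMat :=
  if l.1 = 1 then
    if l.2 then ⟨g.p, g.p + g.q, g.r, g.r + g.s⟩ else ⟨g.p, g.q - g.p, g.r, g.s - g.r⟩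
  else
    if l.2 then ⟨g.p - g.q, g.q, g.r - g.s, g.s⟩ else ⟨g.p + g.q, g.q, g.r + g.s, g.s⟩

/-- The potential at the image of the point `i` of the upper half plane. -/
def edgePot (g : IntMat) : ℤ :=
  if g.r ^ 2 + g.s ^ 2 = 1 then 2 * (g.p * g.r + g.q * g.s)
  else 2 * ((g.p * g.r + g.q * g.s) / (g.r ^ 2 + g.s ^ 2)) + 1

/-- The potential at the image of the sixth root of unity in the upper half plane. -/
def vertexPot (g : IntMat) : ℤ :=
  2 * ((g.p * g.r + g.q * g.s + g.q * g.r) / (g.r ^ 2 + g.r * g.s + g.s ^ 2)) + 1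

/-- The value of the cochain on the edge labelled by a positive generator starting at `g`. -/
def posCost (g : IntMat) (i : ℕ) : ℤ :=
  if i = 1 then 3 * (g.act (i, true)).edgePot - 2 * g.vertexPot
  else 4 * (g.act (i, true)).vertexPot - 3 * g.edgePot

/-- The value of the cochain on the edge labelled by a letter starting at `g`. -/
def cost (g : IntMat) (l : BraidLetter) : ℤ :=
  if l.2 then g.posCost l.1 else -(g.act l).posCost l.1

/-- The matrix reached from `g` by reading a word. -/
def actWord (g : IntMat) (w : BraidWord) : IntMat := w.foldl act g

/-- The sum of the cochain along the path that starts at `g` and reads a word. -/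
def wordCost (g : IntMat) : BraidWord → ℤ
  | [] => 0
  | l :: w => g.cost l + (g.act l).wordCost w

lemma wordCost_append (g : IntMat) (u v : BraidWord) :
    g.wordCost (u ++ v) = g.wordCost u + (g.actWord u).wordCost v := by
  induction u generalizing g with
  | nil => simp [wordCost, actWord]
  | cons l u ih => simp [wordCost, ih, actWord, add_assoc]

lemma actWord_append (g : IntMat) (u v : BraidWord) :
    g.actWord (u ++ v) = (g.actWord u).actWord v := by
  simp [actWord]

lemma det_act (g : IntMat) (l : BraidLetter) : (g.act l).det = g.det := by
  unfold act det
  split_ifs <;> ring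

lemma det_actWord (g : IntMat) (u : BraidWord) : (g.actWord u).det = g.det := by
  induction u generalizing g with
  | nil => rfl
  | cons l u ih => exact (ih (g.act l)).trans (det_act g l)

lemma act_act_not (g : IntMat) (i : ℕ) (b : Bool) : (g.act (i, b)).act (i, !b) = g := by
  cases b <;> by_cases h : i = 1 <;> simp [act, h]

lemma wordCost_cancel (g : IntMat) (i : ℕ) (b : Bool) : g.wordCost [(i, b), (i, !b)] = 0 := by
  have h := act_act_not g i b
  cases b <;> simp_all [wordCost, cost]

lemma actWord_cancel (g : IntMat) (i : ℕ) (b : Bool) : g.actWord [(i, b), (i, !b)] = g :=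
  act_act_not g i b

lemma actWord_braid (g : IntMat) :
    g.actWord [(1, true), (2, true), (1, true)] = g.actWord [(2, true), (1, true), (2, true)] := by
  ext <;> simp [actWord, act]

/-- Unless the lower row is a unit vector, zero does not separate the real parts of the two points
whose floors define `edgePot` and `vertexPot`. -/
lemma nonneg_iff {p q r s : ℤ} (hdet : p * s - q * r = 1) (h : r ^ 2 + s ^ 2 ≠ 1) :
    0 ≤ p * r + q * s ↔ 0 ≤ p * r + q * s + q * r := by
  have hxy : (p * r) * (q * s) = (q * r) * (q * r + 1) := by
    linear_combination (q * r) * hdet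
  have hsq : 4 * ((q * r) * (q * r + 1)) ≤ (p * r + q * s) ^ 2 := by
    nlinarith [sq_nonneg (p * r - q * s)]
  constructor
  · intro h0
    by_contra! h1
    have ht : q * r = -1 := by nlinarith
    have hx : p * r + q * s = 0 := by linarith
    have hps : p * s = 0 := by linarith
    have hr : r * r = 1 := by
      rcases Int.eq_one_or_neg_one_of_mul_eq_neg_one' ht with ⟨-, hr⟩ | ⟨-, hr⟩ <;> simp [hr]
    have hs : s = 0 := by
      rcases mul_eq_zero.mp hps with hp | hs
      · have : q * s = 0 := by simpa [hp] using hx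
        rcases mul_eq_zero.mp this with hq | hs
        · simp [hq] at ht
        · exact hs
      · exact hs
    exact h (by rw [hs]; linarith)
  · intro h0
    by_contra! h1
    nlinarith

lemma div_eq_div {p q r s : ℤ} (hdet : p * s - q * r = 1) (h : r ^ 2 + s ^ 2 ≠ 1) :
    (p * r + q * s) / (r ^ 2 + s ^ 2) =
      (p * r + q * s + q * r) / (r ^ 2 + r * s + s ^ 2) := by
  have hrs : r ≠ 0 ∨ s ≠ 0 := by
    by_contra! h0
    simp [h0.1, h0.2] at hdet
  have hD : 0 < r ^ 2 + s ^ 2 := by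
    rcases hrs with h0 | h0 <;> positivity
  have hE : 0 < r ^ 2 + r * s + s ^ 2 := by nlinarith [sq_nonneg (r + s)]
  refine eq_of_forall_le_iff fun n => ?_
  rw [Int.le_ediv_iff_mul_le hD, Int.le_ediv_iff_mul_le hE]
  have key := nonneg_iff (p := p - n * r) (q := q - n * s) (r := r) (s := s)
    (by linear_combination hdet) h
  constructor
  · intro h1
    have := key.mp (by linarith)
    linarith
  · intro h1
    have := key.mpr (by linarith)
    linarith

lemma abs_edgePot_sub_vertexPot_le {g : IntMat} (hg : g.det = 1) :
    |g.edgePot - g.vertexPot| ≤ 1 := by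
  obtain ⟨p, q, r, s⟩ := g
  simp only [det] at hg
  simp only [edgePot, vertexPot]
  split_ifs with h
  · have hcases : (r = 0 ∧ s * s = 1) ∨ (r * r = 1 ∧ s = 0) := by
      by_cases hr : r = 0
      · left; subst hr; exact ⟨rfl, by linarith⟩
      · right
        have : 0 < r ^ 2 := by positivity
        have hs : s ^ 2 = 0 := le_antisymm (by linarith) (sq_nonneg s)
        exact ⟨by linarith, by simpa using hs⟩
    rcases hcases with ⟨rfl, hs⟩ | ⟨hr, rfl⟩
    · have : s ^ 2 = 1 := by linarith
      simp [this]
    · have hr2 : r ^ 2 = 1 := by linarith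
      have hqr : q * r = -1 := by linarith
      simp only [mul_zero, add_zero, hr2, hqr, ne_eq, OfNat.ofNat_ne_zero, not_false_eq_true,
        zero_pow, Int.ediv_one]
      rw [abs_le]; constructor <;> linarith
  · rw [div_eq_div hg h]; simp

lemma vertexPot_mul_U (p q r s : ℤ) :
    vertexPot ⟨-q, p + q, -s, r + s⟩ = vertexPot ⟨p, q, r, s⟩ := by
  simp only [vertexPot]; ring_nf

lemma edgePot_mul_S (p q r s : ℤ) : edgePot ⟨-q, p, -s, r⟩ = edgePot ⟨p, q, r, s⟩ := by
  simp only [edgePot]; ring_nf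

lemma wordCost_braid (g : IntMat) :
    g.wordCost [(1, true), (2, true), (1, true)] - g.wordCost [(2, true), (1, true), (2, true)] =
      6 * (edgePot ⟨-g.q, g.p, -g.s, g.r⟩ - vertexPot ⟨-g.q, g.p, -g.s, g.r⟩) := by
  obtain ⟨p, q, r, s⟩ := g
  have h1 := vertexPot_mul_U p q r s
  have h2 := vertexPot_mul_U (p - q) q (r - s) s
  have h3 := edgePot_mul_S p q r s
  simp only [sub_add_cancel] at h2
  simp [wordCost, cost, posCost, act, h1, h2, h3]
  ring

lemma abs_wordCost_braid_le {g : IntMat} (hg : g.det = 1) :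
    |g.wordCost [(1, true), (2, true), (1, true)] -
      g.wordCost [(2, true), (1, true), (2, true)]| ≤ 6 := by
  have h := abs_edgePot_sub_vertexPot_le (g := ⟨-g.q, g.p, -g.s, g.r⟩)
    (by simp only [det] at hg ⊢; linarith)
  rw [wordCost_braid, abs_mul]
  norm_num
  linarith

lemma abs_wordCost_sub_le_of_move1 {g : IntMat} (hg : g.det = 1) {a b : BraidWord}
    (h : Move1 3 a b) : |g.wordCost a - g.wordCost b| ≤ 6 := by
  cases h with
  | fwd u v i h1 h2 =>
    obtain rfl : i = 1 := by omega
    simpa [-List.append_assoc, wordCost_append, actWord_append, actWord_braid] using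
      abs_wordCost_braid_le ((det_actWord g u).trans hg)
  | bwd u v i h1 h2 =>
    obtain rfl : i = 1 := by omega
    rw [abs_sub_comm]
    simpa [-List.append_assoc, wordCost_append, actWord_append, actWord_braid] using
      abs_wordCost_braid_le ((det_actWord g u).trans hg)

lemma wordCost_eq_of_move3 {n : ℕ} (g : IntMat) {a b : BraidWord} (h : Move3 n a b) :
    g.wordCost a = g.wordCost b := by
  cases h <;> simp only [wordCost_append, actWord_append, wordCost_cancel, actWord_cancel, add_zero]

lemma abs_wordCost_sub_le_of_reach {g : IntMat} (hg : g.det = 1) {c : ℕ} {a b : BraidWord}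
    (h : Reach 3 c a b) : |g.wordCost a - g.wordCost b| ≤ 6 * c := by
  induction h with
  | refl a => simp
  | step1 m _ ih =>
    have := abs_wordCost_sub_le_of_move1 hg m
    rw [abs_le] at *
    push_cast
    constructor <;> linarith
  | step2 m _ ih =>
    cases m with
    | swap u v i j h1 h2 h3 h4 h5 => omega
  | step3 m _ ih => rwa [wordCost_eq_of_move3 g m]

/-! ### The value on `a_k` -/

/-- The image of `± σ₁^i`, the sign being `e`. -/
def shear (e i : ℤ) : IntMat := ⟨e, e * i, 0, e⟩

/-- Reading `w` from `shear e i` costs `2αi + β` and leads to `shear (τe) (i + δ)`. -/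
def Translates (w : BraidWord) (α β δ τ : ℤ) : Prop :=
  ∀ e i : ℤ, e ^ 2 = 1 → ∀ v : BraidWord, (shear e i).wordCost (w ++ v) =
    2 * α * i + β + (shear (τ * e) (i + δ)).wordCost v

lemma translates_V : Translates V 2 10 2 1 := by
  intro e i he v
  rcases sq_eq_one_iff.mp he with rfl | rfl <;>
  · simp [V, wordCost, cost, posCost, act, shear, edgePot, vertexPot]
    ring_nf

lemma translates_W : Translates W 4 (-14) (-2) (-1) := by
  intro e i he v
  rcases sq_eq_one_iff.mp he with rfl | rfl <;>
  · simp [W, wordCost, cost, posCost, act, shear, edgePot, vertexPot]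
    ring_nf

lemma Translates.winv {w : BraidWord} {α β δ τ : ℤ} (h : Translates w α β δ τ) (hw : IsWord 3 w)
    (hτ : τ ^ 2 = 1) : Translates (winv w) (-α) (2 * α * δ - β) (-δ) τ := by
  intro e i he v
  have he' : (τ * e) ^ 2 = 1 := by rw [mul_pow, hτ, he, one_mul]
  have h1 := h (τ * e) (i - δ) he' (Braid.winv w ++ v)
  have h2 := abs_wordCost_sub_le_of_reach (g := shear (τ * e) (i - δ))
    (by simp only [det, shear]; linarith) ((reach_append_winv hw).context [] v)
  have h3 : τ * (τ * e) = e := by rw [← mul_assoc, ← sq, hτ, one_mul]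
  simp only [List.nil_append, List.append_assoc, CharP.cast_eq_zero, mul_zero, abs_nonpos_iff,
    sub_eq_zero] at h2
  rw [h2, h3, sub_add_cancel] at h1
  rw [← sub_eq_add_neg, h1]
  ring

lemma Translates.wpow {w : BraidWord} {α β δ τ : ℤ} (h : Translates w α β δ τ)
    (hτ : τ ^ 2 = 1) (k : ℕ) :
    Translates (wpow w k) (k * α) (k * β + α * δ * (k * (k - 1))) (k * δ) (τ ^ k) := by
  induction k with
  | zero => intro e i he v; simp [Braid.wpow]
  | succ k ih =>
    intro e i he v
    have he' : (τ * e) ^ 2 = 1 := by rw [mul_pow, hτ, he, one_mul]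
    rw [wpow_succ, List.append_assoc, h e i he, ih (τ * e) (i + δ) he',
      ← mul_assoc (τ ^ k), ← pow_succ]
    push_cast
    ring_nf

lemma wordCost_ak (k : ℕ) : (shear 1 0).wordCost (ak k) = 24 * k ^ 2 := by
  have hV := translates_V.wpow (by norm_num) k
  have hW := translates_W.wpow (by norm_num) k
  have hV' := hV.winv (isWord_V.wpow k) (by simp)
  have hW' := hW.winv (isWord_W.wpow k) (by simp [← pow_mul'])
  have hs : ((-1 : ℤ) ^ k) ^ 2 = 1 := by simp [← pow_mul']
  rw [ak, List.append_assoc, List.append_assoc, hW' 1 0 (by norm_num), hV _ _ (by simp [hs]),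
    hW _ _ (by simp [hs]), ← List.append_nil (winv (wpow V k)), hV' _ _
    (by simp [hs, ← sq])]
  simp only [wordCost]
  ring

end IntMat

lemma length_ak (k : ℕ) : (ak k).length = 12 * k := by
  simp [ak, winv, wpow, V, W]
  ring

lemma le_of_reach_ak {k c : ℕ} (h : Reach 3 c (ak k) []) : 4 * k ^ 2 ≤ c := by
  have h1 := IntMat.abs_wordCost_sub_le_of_reach (g := IntMat.shear 1 0)
    (by simp [IntMat.det, IntMat.shear]) h
  rw [IntMat.wordCost_ak, IntMat.wordCost, sub_zero] at h1
  have h2 := (le_abs_self _).trans h1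
  zify
  linarith

/-- For every `k ≥ 1`, the word `a_k = W^{-k} V^k W^k V^{-k}` has length `12k`,
represents the identity element of `B_3`, and `d(a_k, E) = 4k²` where `E` is the
empty word. -/
theorem statement_10 (k : ℕ) (hk : 1 ≤ k) :
    (ak k).length = 12 * k ∧ eval 3 (ak k) = 1 ∧ braidDist 3 (ak k) [] = 4 * k ^ 2 := by
  refine ⟨length_ak k, (reach_ak k).eval_eq, le_antisymm (Nat.sInf_le (reach_ak k)) ?_⟩
  exact le_csInf ⟨_, reach_ak k⟩ fun c hc => le_of_reach_ak hc

end Braid
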